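/- Let K be a field complete with respect to a nonarchimedean multiplicative norm |·|, let t ∈ K with |t| > 1, and define λ(t) = ∏_{i∈ℤ} ((t^{2i+1}+1)/(t^{2i+1}−1))^4 (a multipliable ℤ-indexed product, and λ(t) ≠ 0). Then λ(−t) = λ(t)^{−1}. -/

import Mathlib

theorem tate_aux_norm {K : Type*} [NormedField K] [IsUltrametricDist K] (a : K) (h : ‖a‖ ≠ 1) :
    ‖a + 1‖ = max ‖a‖ 1 ∧ ‖a - 1‖ = max ‖a‖ 1 := by
  constructor
  · have := IsUltrametricDist.norm_add_eq_max_of_norm_ne_norm (x := a) (y := 1) (by simpa using h)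
    simpa using this
  · have := IsUltrametricDist.norm_add_eq_max_of_norm_ne_norm (x := a) (y := -1) (by simpa using h)
    simpa [sub_eq_add_neg] using this

theorem tate_aux_bound {K : Type*} [NormedField K] [IsUltrametricDist K] (a : K) (h : ‖a‖ ≠ 1)
    (h0 : a ≠ 0) :
    ‖(a + 1) / (a - 1)‖ = 1 ∧ ‖((a + 1) / (a - 1)) ^ 4 - 1‖ ≤ ‖a‖ ∧
      ‖((a + 1) / (a - 1)) ^ 4 - 1‖ ≤ ‖a‖⁻¹ := by
  obtain ⟨hp, hm⟩ := tate_aux_norm a h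
  have hpos : 0 < max ‖a‖ 1 := lt_max_of_lt_right one_pos
  have hne : a - 1 ≠ 0 := by
    rw [← norm_ne_zero_iff, hm]; exact hpos.ne'
  have hu : ‖(a + 1) / (a - 1)‖ = 1 := by
    rw [norm_div, hp, hm, div_self hpos.ne']
  have h2 : ‖(2 : K)‖ ≤ 1 := by
    have := IsUltrametricDist.norm_add_le_max (1 : K) 1
    rw [one_add_one_eq_two] at this
    simpa using this
  have e1 : (a + 1) / (a - 1) - 1 = 2 / (a - 1) := by field_simp; ring
  have e2 : (a + 1) / (a - 1) + 1 = 2 * a / (a - 1) := by field_simp; ring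
  set u := (a + 1) / (a - 1) with hudef
  have k1 : ‖u - 1‖ ≤ 1 := by
    have := IsUltrametricDist.norm_add_le_max u (-1)
    simpa [hu, sub_eq_add_neg] using this
  have k2 : ‖u + 1‖ ≤ 1 := by
    have := IsUltrametricDist.norm_add_le_max u 1
    simpa [hu] using this
  have k3 : ‖u ^ 2 + 1‖ ≤ 1 := by
    have := IsUltrametricDist.norm_add_le_max (u ^ 2) 1
    simpa [hu] using this
  have k4 : ‖u - 1‖ ≤ ‖a‖⁻¹ := by
    rw [e1, norm_div, hm, ← one_div]
    exact div_le_div₀ zero_le_one h2 (norm_pos_iff.2 h0) (le_max_left _ _)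
  have k5 : ‖u + 1‖ ≤ ‖a‖ := by
    rw [e2, norm_div, hm, norm_mul, div_le_iff₀ hpos, mul_comm]
    exact mul_le_mul_of_nonneg_left (h2.trans (le_max_right _ _)) (norm_nonneg _)
  have e : ‖u ^ 4 - 1‖ = ‖u - 1‖ * ‖u + 1‖ * ‖u ^ 2 + 1‖ := by
    rw [← norm_mul, ← norm_mul]; congr 1; ring
  have p1 := norm_nonneg (u - 1)
  have p2 := norm_nonneg (u + 1)
  have p3 := norm_nonneg (u ^ 2 + 1)
  refine ⟨hu, ?_, ?_⟩ <;> rw [e]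
  · calc _ ≤ ‖u - 1‖ * ‖u + 1‖ := mul_le_of_le_one_right (by positivity) k3
      _ ≤ ‖u + 1‖ := mul_le_of_le_one_left p2 k1
      _ ≤ _ := k5
  · calc _ ≤ ‖u - 1‖ * ‖u + 1‖ := mul_le_of_le_one_right (by positivity) k3
      _ ≤ ‖u - 1‖ := mul_le_of_le_one_right p1 k2
      _ ≤ _ := k4

theorem tate_aux_ne {K : Type*} [NormedField K] (t : K) (ht : 1 < ‖t‖) (i : ℤ) :
    ‖t ^ (2 * i + 1)‖ ≠ 1 := by
  rw [norm_zpow]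
  intro h
  rw [zpow_eq_one_iff_right₀ (by positivity) ht.ne'] at h
  omega

/-- For `|t| > 1` in a field complete with respect to a nonarchimedean multiplicative norm, the
cross ratio `λ(t) = ∏_{i ∈ ℤ} ((t^(2i+1)+1)/(t^(2i+1)-1))^4` of the Tate curve with period
`q = t⁻²` is given by a multipliable product, is nonzero, and satisfies `λ(-t) = λ(t)⁻¹`. -/
theorem tate_lambda_neg
    {K : Type*} [NormedField K] [CompleteSpace K] [IsUltrametricDist K]
    (t : K) (ht : 1 < ‖t‖) :
    (Multipliable fun i : ℤ => ((t ^ (2 * i + 1) + 1) / (t ^ (2 * i + 1) - 1)) ^ 4) ∧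
      (∏' i : ℤ, ((t ^ (2 * i + 1) + 1) / (t ^ (2 * i + 1) - 1)) ^ 4) ≠ 0 ∧
      ∏' i : ℤ, (((-t) ^ (2 * i + 1) + 1) / ((-t) ^ (2 * i + 1) - 1)) ^ 4 =
        (∏' i : ℤ, ((t ^ (2 * i + 1) + 1) / (t ^ (2 * i + 1) - 1)) ^ 4)⁻¹ := by
  have t0 : t ≠ 0 := norm_pos_iff.1 (one_pos.trans ht)
  have hb := fun i : ℤ => tate_aux_bound (t ^ (2 * i + 1)) (tate_aux_ne t ht i) (zpow_ne_zero _ t0)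
  have hgeo : Summable fun n : ℕ => (‖t‖⁻¹) ^ n :=
    summable_geometric_of_lt_one (by positivity) (inv_lt_one_of_one_lt₀ ht)
  have hgeo' : Summable fun n : ℕ => (‖t‖⁻¹) ^ (2 * n + 1) :=
    hgeo.comp_injective (i := fun n : ℕ => 2 * n + 1) (fun a b h => by simpa using h)
  have hs : Summable fun i : ℤ =>
      ‖((t ^ (2 * i + 1) + 1) / (t ^ (2 * i + 1) - 1)) ^ 4 - 1‖ := by
    apply Summable.of_nat_of_neg_add_one
    · refine Summable.of_nonneg_of_le (fun _ => norm_nonneg _) (fun n => ?_) hgeo'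
      refine (hb n).2.2.trans (le_of_eq ?_)
      rw [norm_zpow, inv_pow]
      norm_cast
    · refine Summable.of_nonneg_of_le (fun _ => norm_nonneg _) (fun n => ?_) hgeo'
      refine (hb _).2.1.trans (le_of_eq ?_)
      rw [norm_zpow, inv_pow, show 2 * (-((n : ℤ) + 1)) + 1 = -((2 * n + 1 : ℕ) : ℤ) by
        push_cast; ring, zpow_neg, zpow_natCast]
  have hM : Multipliable fun i : ℤ =>
      ((t ^ (2 * i + 1) + 1) / (t ^ (2 * i + 1) - 1)) ^ 4 := by
    have := multipliable_one_add_of_summable hs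
    simpa using this
  have hne : (∏' i : ℤ, ((t ^ (2 * i + 1) + 1) / (t ^ (2 * i + 1) - 1)) ^ 4) ≠ 0 := by
    have h1 := (continuous_norm.tendsto _).comp hM.hasProd
    have h2 : ‖∏' i : ℤ, ((t ^ (2 * i + 1) + 1) / (t ^ (2 * i + 1) - 1)) ^ 4‖ = 1 := by
      refine tendsto_nhds_unique h1 (tendsto_const_nhds.congr fun s => ?_)
      simp only [Function.comp, norm_prod, norm_pow]
      exact (Finset.prod_eq_one fun i _ => by rw [(hb i).1, one_pow]).symm
    intro h
    rw [h, norm_zero] at h2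
    exact zero_ne_one h2
  refine ⟨hM, hne, ?_⟩
  rw [← (hM.hasProd.inv₀ hne).tprod_eq]
  refine tprod_congr fun i => ?_
  rw [Odd.neg_zpow ⟨i, rfl⟩, ← inv_pow, inv_div]
  congr 1
  rw [← neg_div_neg_eq]
  congr 1 <;> ring
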